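/- Let 1 ≤ a ≤ b and c ≥ ab. Then C(a,b,c) = {(λ_A, λ_B, λ_C) : λ_C is obtained from some λ_{AB} ∈ ℝ^{ab} by appending c − ab zeros, where (λ_A, λ_B, λ_{AB}) ∈ C(a,b,ab)}. -/

import Mathlib

open scoped BigOperators

noncomputable section

/-- The reduced density matrix on the first subsystem. -/
def rhoA {a b c : ℕ} (ψ : Fin a × Fin b × Fin c → ℂ) : Matrix (Fin a) (Fin a) ℂ :=
  Matrix.of fun i i' => ∑ j : Fin b, ∑ k : Fin c, ψ (i, j, k) * (starRingEnd ℂ) (ψ (i', j, k))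

/-- The reduced density matrix on the second subsystem. -/
def rhoB {a b c : ℕ} (ψ : Fin a × Fin b × Fin c → ℂ) : Matrix (Fin b) (Fin b) ℂ :=
  Matrix.of fun j j' => ∑ i : Fin a, ∑ k : Fin c, ψ (i, j, k) * (starRingEnd ℂ) (ψ (i, j', k))

/-- The reduced density matrix on the third subsystem. -/
def rhoC {a b c : ℕ} (ψ : Fin a × Fin b × Fin c → ℂ) : Matrix (Fin c) (Fin c) ℂ :=
  Matrix.of fun k k' => ∑ i : Fin a, ∑ j : Fin b, ψ (i, j, k) * (starRingEnd ℂ) (ψ (i, j, k'))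

/-- `lam` is the vector of eigenvalues of `ρ`, listed in nonincreasing order
with multiplicity. -/
def IsSpecDown {n : ℕ} (ρ : Matrix (Fin n) (Fin n) ℂ) (lam : Fin n → ℝ) : Prop :=
  Antitone lam ∧ ∃ (hρ : ρ.IsHermitian) (σ : Equiv.Perm (Fin n)), lam = hρ.eigenvalues ∘ σ

/-- The Kronecker cone `C(a,b,c)`. -/
def KronCone (a b c : ℕ) : Set ((Fin a → ℝ) × (Fin b → ℝ) × (Fin c → ℝ)) :=
  { lam | ∃ ψ : Fin a × Fin b × Fin c → ℂ,
      IsSpecDown (rhoA ψ) lam.1 ∧ IsSpecDown (rhoB ψ) lam.2.1 ∧ IsSpecDown (rhoC ψ) lam.2.2 }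

/-- The pairing `⟨(H,z), λ⟩`. -/
def wtPair {a b c : ℕ} (HA : Fin a → ℝ) (HB : Fin b → ℝ) (HC : Fin c → ℝ) (z : ℝ)
    (lam : (Fin a → ℝ) × (Fin b → ℝ) × (Fin c → ℝ)) : ℝ :=
  (∑ i, HA i * lam.1 i) + (∑ j, HB j * lam.2.1 j) + (∑ k, HC k * lam.2.2 k)
    + z * ∑ i, lam.1 i

/-- `H = (H_A, H_B, H_C)` is traceless. -/
def Traceless {a b c : ℕ} (HA : Fin a → ℝ) (HB : Fin b → ℝ) (HC : Fin c → ℝ) : Prop :=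
  (∑ i, HA i) = 0 ∧ (∑ j, HB j) = 0 ∧ (∑ k, HC k) = 0

/-- `(H, z)` is a facet normal of the Kronecker cone `C(a,b,c)`. -/
def IsFacetNormal (a b c : ℕ) (HA : Fin a → ℝ) (HB : Fin b → ℝ) (HC : Fin c → ℝ)
    (z : ℝ) : Prop :=
  Traceless HA HB HC ∧ ¬(HA = 0 ∧ HB = 0 ∧ HC = 0 ∧ z = 0) ∧
  (∀ lam ∈ KronCone a b c, 0 ≤ wtPair HA HB HC z lam) ∧
  Module.finrank ℝ
    (affineSpan ℝ {lam ∈ KronCone a b c | wtPair HA HB HC z lam = 0}).direction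
    = a + b + c - 3

/-- `(H, z)` is a trivial (Weyl chamber) normal. -/
def IsTrivialNormal {a b c : ℕ} (HA : Fin a → ℝ) (HB : Fin b → ℝ) (HC : Fin c → ℝ)
    (z : ℝ) : Prop :=
  ∃ t : ℝ, 0 < t ∧
    ((∃ i i' : Fin a, i < i' ∧ HA = t • (Pi.single i 1 - Pi.single i' 1) ∧
        HB = 0 ∧ HC = 0 ∧ z = 0) ∨
     (∃ j j' : Fin b, j < j' ∧ HB = t • (Pi.single j 1 - Pi.single j' 1) ∧
        HA = 0 ∧ HC = 0 ∧ z = 0) ∨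
     (∃ k k' : Fin c, k < k' ∧ HC = t • (Pi.single k 1 - Pi.single k' 1) ∧
        HA = 0 ∧ HB = 0 ∧ z = 0))

/-- The subspace of vectors supported on coordinates satisfying `P`. -/
def suppSubmodule {ι : Type*} (P : ι → Prop) : Submodule ℂ (ι → ℂ) where
  carrier := {ψ | ∀ p, ¬ P p → ψ p = 0}
  add_mem' := by
    intro x y hx hy p hp
    simp only [Pi.add_apply, hx p hp, hy p hp, add_zero]
  zero_mem' := by intro p _; rfl
  smul_mem' := by
    intro r x hx p hp
    simp only [Pi.smul_apply, hx p hp, smul_zero]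

/-- The zero-weight space `ℋ₀(H,z)`. -/
def weight0Space {a b c : ℕ} (HA : Fin a → ℝ) (HB : Fin b → ℝ) (HC : Fin c → ℝ)
    (z : ℝ) : Submodule ℂ (Fin a × Fin b × Fin c → ℂ) :=
  suppSubmodule fun p => HA p.1 + HB p.2.1 + HC p.2.2 + z = 0

/-- The negative-weight space `ℋ₋(H,z)`. -/
def weightNegSpace {a b c : ℕ} (HA : Fin a → ℝ) (HB : Fin b → ℝ) (HC : Fin c → ℝ)
    (z : ℝ) : Submodule ℂ (Fin a × Fin b × Fin c → ℂ) :=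
  suppSubmodule fun p => HA p.1 + HB p.2.1 + HC p.2.2 + z < 0

/-- Strictly lower triangular matrices `X` with `X i' i = 0` unless
`i < i'` and `Hv i' < Hv i`. -/
def lowerMod {d : ℕ} (Hv : Fin d → ℝ) : Submodule ℂ (Matrix (Fin d) (Fin d) ℂ) where
  carrier := {X | ∀ i' i, ¬ (i < i' ∧ Hv i' < Hv i) → X i' i = 0}
  add_mem' := by
    intro X Y hX hY i' i h
    simp only [Matrix.add_apply, hX i' i h, hY i' i h, add_zero]
  zero_mem' := by intro i' i h; rfl
  smul_mem' := by
    intro r X hX i' i h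
    simp only [Matrix.smul_apply, hX i' i h, smul_zero]

/-- The nilpotent algebra `𝔫₋(H)`. -/
def nMinusMod {a b c : ℕ} (HA : Fin a → ℝ) (HB : Fin b → ℝ) (HC : Fin c → ℝ) :
    Submodule ℂ (Matrix (Fin a) (Fin a) ℂ × Matrix (Fin b) (Fin b) ℂ ×
      Matrix (Fin c) (Fin c) ℂ) :=
  (lowerMod HA).prod ((lowerMod HB).prod (lowerMod HC))

/-- The infinitesimal action `(X,Y,Z) ↦ (X⊗I⊗I + I⊗Y⊗I + I⊗I⊗Z)ψ`. -/
def act {a b c : ℕ}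
    (t : Matrix (Fin a) (Fin a) ℂ × Matrix (Fin b) (Fin b) ℂ × Matrix (Fin c) (Fin c) ℂ)
    (ψ : Fin a × Fin b × Fin c → ℂ) : Fin a × Fin b × Fin c → ℂ := fun p =>
  (∑ i', t.1 p.1 i' * ψ (i', p.2.1, p.2.2)) +
  (∑ j', t.2.1 p.2.1 j' * ψ (p.1, j', p.2.2)) +
  (∑ k', t.2.2 p.2.2 k' * ψ (p.1, p.2.1, k'))

/-- The action as a linear map in `(X,Y,Z)`. -/
def actL {a b c : ℕ} (ψ : Fin a × Fin b × Fin c → ℂ) :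
    (Matrix (Fin a) (Fin a) ℂ × Matrix (Fin b) (Fin b) ℂ × Matrix (Fin c) (Fin c) ℂ)
      →ₗ[ℂ] (Fin a × Fin b × Fin c → ℂ) where
  toFun t := act t ψ
  map_add' t s := by
    funext p
    simp only [act, Prod.fst_add, Prod.snd_add, Matrix.add_apply, add_mul,
      Finset.sum_add_distrib, Pi.add_apply]
    ring
  map_smul' r t := by
    funext p
    simp only [act, Prod.smul_fst, Prod.smul_snd, Matrix.smul_apply, smul_eq_mul,
      Pi.smul_apply, RingHom.id_apply, Finset.mul_sum, mul_assoc, mul_add]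

/-- The tangent map `T_ψ : 𝔫₋(H) → ℋ₋(H,z)` is a linear isomorphism. -/
def TangentIso {a b c : ℕ} (HA : Fin a → ℝ) (HB : Fin b → ℝ) (HC : Fin c → ℝ)
    (z : ℝ) (ψ : Fin a × Fin b × Fin c → ℂ) : Prop :=
  ∃ h : ∀ t ∈ nMinusMod HA HB HC, actL ψ t ∈ weightNegSpace HA HB HC z,
    Function.Bijective ((actL ψ).restrict h)

/-- The tangent map `T_ψ : 𝔫₋(H) → ℋ₋(H,z)` is surjective. -/
def TangentSurj {a b c : ℕ} (HA : Fin a → ℝ) (HB : Fin b → ℝ) (HC : Fin c → ℝ)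
    (z : ℝ) (ψ : Fin a × Fin b × Fin c → ℂ) : Prop :=
  ∃ h : ∀ t ∈ nMinusMod HA HB HC, actL ψ t ∈ weightNegSpace HA HB HC z,
    Function.Surjective ((actL ψ).restrict h)

/-- `(H,z)` is admissible: the hyperplane `⟨(H,z), ·⟩ = 0` in `V` is spanned by
the weights of zero `(H,z)`-weight. -/
def Admissible {a b c : ℕ} (HA : Fin a → ℝ) (HB : Fin b → ℝ) (HC : Fin c → ℝ)
    (z : ℝ) : Prop :=
  (Submodule.span ℝ
    { w : (Fin a → ℝ) × (Fin b → ℝ) × (Fin c → ℝ) |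
      ∃ i j k, HA i + HB j + HC k + z = 0 ∧
        w = (Pi.single i 1, Pi.single j 1, Pi.single k 1) } : Set _)
  = { lam | (∑ i, lam.1 i) = (∑ j, lam.2.1 j) ∧ (∑ i, lam.1 i) = (∑ k, lam.2.2 k) ∧
        wtPair HA HB HC z lam = 0 }

/-- `(H,z)` is a Ressayre element. -/
def IsRessayre {a b c : ℕ} (HA : Fin a → ℝ) (HB : Fin b → ℝ) (HC : Fin c → ℝ)
    (z : ℝ) : Prop :=
  Traceless HA HB HC ∧ ¬(HA = 0 ∧ HB = 0 ∧ HC = 0 ∧ z = 0) ∧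
  Admissible HA HB HC z ∧
  ∃ ψ ∈ weight0Space HA HB HC z, TangentIso HA HB HC z ψ

/-- `(H_A, H_B)` satisfies the extremal-edge condition. -/
def ExtremalEdge {a b : ℕ} (HA : Fin a → ℝ) (HB : Fin b → ℝ) : Prop :=
  (∑ i, HA i) = 0 ∧ (∑ j, HB j) = 0 ∧ ¬(HA = 0 ∧ HB = 0) ∧
  ∀ (x : Fin a → ℝ) (y : Fin b → ℝ), (∑ i, x i) = 0 → (∑ j, y j) = 0 →
    (∀ i j k l, HA i + HB j = HA k + HB l → x i + y j = x k + y l) →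
    ∃ t : ℝ, x = t • HA ∧ y = t • HB

section

open scoped ComplexOrder MatrixOrder

/-- The flattening of `ψ` along the bipartition `AB | C`. -/
def flattenAB {a b c : ℕ} (ψ : Fin a × Fin b × Fin c → ℂ) :
    Matrix (Fin a × Fin b) (Fin c) ℂ :=
  Matrix.of fun p k => ψ (p.1, p.2, k)

/-- The reduced density matrix on the first two subsystems. -/
def rhoAB {a b c : ℕ} (ψ : Fin a × Fin b × Fin c → ℂ) :
    Matrix (Fin a × Fin b) (Fin a × Fin b) ℂ :=
  flattenAB ψ * (flattenAB ψ).conjTranspose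

lemma rhoA_eq_partialTrace {a b c : ℕ} (ψ : Fin a × Fin b × Fin c → ℂ) :
    rhoA ψ = Matrix.of fun i i' => ∑ j, rhoAB ψ (i, j) (i', j) := by
  ext i i'
  simp [rhoA, rhoAB, flattenAB, Matrix.mul_apply]

lemma rhoB_eq_partialTrace {a b c : ℕ} (ψ : Fin a × Fin b × Fin c → ℂ) :
    rhoB ψ = Matrix.of fun j j' => ∑ i, rhoAB ψ (i, j) (i, j') := by
  ext j j'
  simp [rhoB, rhoAB, flattenAB, Matrix.mul_apply]

lemma rhoC_eq_mul_conjTranspose {a b c : ℕ} (ψ : Fin a × Fin b × Fin c → ℂ) :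
    rhoC ψ = (flattenAB ψ).transpose * (flattenAB ψ).transpose.conjTranspose := by
  ext k k'
  simp [rhoC, flattenAB, Matrix.mul_apply, Fintype.sum_prod_type]

lemma rhoC_posSemidef {a b c : ℕ} (ψ : Fin a × Fin b × Fin c → ℂ) : (rhoC ψ).PosSemidef := by
  rw [rhoC_eq_mul_conjTranspose]
  exact Matrix.posSemidef_self_mul_conjTranspose _

lemma rhoC_isHermitian {a b c : ℕ} (ψ : Fin a × Fin b × Fin c → ℂ) : (rhoC ψ).IsHermitian :=
  (rhoC_posSemidef ψ).isHermitian

open Polynomial in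
lemma X_pow_mul_charpoly_rhoC {a b c : ℕ} (ψ : Fin a × Fin b × Fin c → ℂ) :
    (X : ℂ[X]) ^ (a * b) * (rhoC ψ).charpoly = X ^ c * (rhoAB ψ).charpoly := by
  have h := Matrix.charpoly_mul_comm' (flattenAB ψ).transpose
    (flattenAB ψ).transpose.conjTranspose
  rw [← rhoC_eq_mul_conjTranspose] at h
  have h' : (flattenAB ψ).transpose.conjTranspose * (flattenAB ψ).transpose
      = (rhoAB ψ).transpose := by
    rw [rhoAB, Matrix.transpose_mul]
    rfl
  rw [h', Matrix.charpoly_transpose] at h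
  simpa using h

/-- Every state on `AB ⊗ C` has the same `AB` marginal as a state with `dim C = ab`. -/
lemma exists_rhoAB_eq {a b c : ℕ} (ψ : Fin a × Fin b × Fin c → ℂ) :
    ∃ φ : Fin a × Fin b × Fin (a * b) → ℂ, rhoAB φ = rhoAB ψ := by
  have hpos : (rhoAB ψ).PosSemidef := Matrix.posSemidef_self_mul_conjTranspose _
  obtain ⟨B, hB⟩ := CStarAlgebra.nonneg_iff_eq_star_mul_self.mp hpos.nonneg
  rw [Matrix.star_eq_conjTranspose] at hB
  refine ⟨fun p => B.conjTranspose (p.1, p.2.1) (finProdFinEquiv.symm p.2.2), ?_⟩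
  rw [hB]
  ext p q
  rw [rhoAB, Matrix.mul_apply, Matrix.mul_apply,
    ← Equiv.sum_comp (finProdFinEquiv (m := a) (n := b))]
  simp [flattenAB, -finProdFinEquiv_symm_apply]

/-- A state can be embedded into a larger third factor without changing its `AB` marginal. -/
lemma exists_rhoAB_eq_of_le {a b n c : ℕ} (hc : n ≤ c) (φ : Fin a × Fin b × Fin n → ℂ) :
    ∃ ψ : Fin a × Fin b × Fin c → ℂ, rhoAB ψ = rhoAB φ := by
  obtain ⟨d, rfl⟩ := Nat.exists_eq_add_of_le hc
  refine ⟨fun p => if h : (p.2.2 : ℕ) < n then φ (p.1, p.2.1, ⟨p.2.2, h⟩) else 0, ?_⟩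
  ext p q
  simp [rhoAB, flattenAB, Matrix.mul_apply, Fin.sum_univ_add]

lemma Antitone.eq_of_multiset_map_eq {n : ℕ} {f g : Fin n → ℝ} (hf : Antitone f)
    (hg : Antitone g)
    (h : Multiset.map f Finset.univ.val = Multiset.map g Finset.univ.val) : f = g := by
  rw [Fin.univ_val_map, Fin.univ_val_map, Multiset.coe_eq_coe] at h
  exact List.ofFn_injective (h.eq_of_pairwise' hf.sortedGE_ofFn.pairwise
    hg.sortedGE_ofFn.pairwise)

lemma exists_isSpecDown {n : ℕ} {ρ : Matrix (Fin n) (Fin n) ℂ} (hρ : ρ.IsHermitian) :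
    ∃ lam, IsSpecDown ρ lam := by
  refine ⟨hρ.eigenvalues ∘ Tuple.sort (fun i => -hρ.eigenvalues i), ?_, hρ, _, rfl⟩
  intro i j hij
  have := Tuple.monotone_sort (fun i => -hρ.eigenvalues i) hij
  simpa using this

open Polynomial in
lemma IsSpecDown.charpoly_eq {n : ℕ} {ρ : Matrix (Fin n) (Fin n) ℂ} {lam : Fin n → ℝ}
    (h : IsSpecDown ρ lam) : ρ.charpoly = ∏ i, (X - C (lam i : ℂ)) := by
  obtain ⟨-, hρ, σ, rfl⟩ := h
  rw [hρ.charpoly_eq]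
  exact (Equiv.prod_comp σ fun i => (X - C (hρ.eigenvalues i : ℂ))).symm

open Polynomial in
lemma Antitone.eq_of_prod_X_sub_C_eq {n : ℕ} {f g : Fin n → ℝ} (hf : Antitone f)
    (hg : Antitone g) (h : ∏ i, (X - C (f i : ℂ)) = ∏ i, (X - C (g i : ℂ))) : f = g := by
  refine hf.eq_of_multiset_map_eq hg (Multiset.map_injective Complex.ofReal_injective ?_)
  have h' := congrArg Polynomial.roots h
  rw [Polynomial.roots_prod _ _ (Finset.prod_ne_zero_iff.mpr fun i _ => X_sub_C_ne_zero _),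
    Polynomial.roots_prod _ _ (Finset.prod_ne_zero_iff.mpr fun i _ => X_sub_C_ne_zero _)] at h'
  simpa [Multiset.map_map, Function.comp_def] using h'

lemma IsSpecDown.unique {n : ℕ} {ρ : Matrix (Fin n) (Fin n) ℂ} {lam mu : Fin n → ℝ}
    (h : IsSpecDown ρ lam) (h' : IsSpecDown ρ mu) : lam = mu :=
  h.1.eq_of_prod_X_sub_C_eq h'.1 (h.charpoly_eq.symm.trans h'.charpoly_eq)

open Polynomial in
lemma isSpecDown_of_charpoly_eq {n : ℕ} {ρ : Matrix (Fin n) (Fin n) ℂ} {lam : Fin n → ℝ}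
    (hρ : ρ.IsHermitian) (hlam : Antitone lam) (h : ρ.charpoly = ∏ i, (X - C (lam i : ℂ))) :
    IsSpecDown ρ lam := by
  obtain ⟨mu, hmu⟩ := exists_isSpecDown hρ
  rwa [hlam.eq_of_prod_X_sub_C_eq hmu.1 (h.symm.trans hmu.charpoly_eq)]

lemma IsSpecDown.nonneg {n : ℕ} {ρ : Matrix (Fin n) (Fin n) ℂ} {lam : Fin n → ℝ}
    (h : IsSpecDown ρ lam) (hρ : ρ.PosSemidef) (i : Fin n) : 0 ≤ lam i := by
  obtain ⟨-, _, σ, rfl⟩ := h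
  exact hρ.eigenvalues_nonneg _

/-- If two states have the same `AB` marginal, then the spectrum on the larger third factor is
obtained from the one on the factor of dimension `ab` by appending zeros. -/
lemma IsSpecDown.rhoC_pad {a b c : ℕ} (hc : a * b ≤ c) {ψ : Fin a × Fin b × Fin c → ℂ}
    {φ : Fin a × Fin b × Fin (a * b) → ℂ} (h : rhoAB ψ = rhoAB φ) {lam : Fin (a * b) → ℝ}
    (hlam : IsSpecDown (rhoC φ) lam) :
    IsSpecDown (rhoC ψ)
      (fun k : Fin c => if h : (k : ℕ) < a * b then lam ⟨k, h⟩ else 0) := by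
  have hnonneg := hlam.nonneg (rhoC_posSemidef φ)
  refine isSpecDown_of_charpoly_eq (rhoC_isHermitian ψ) ?_ ?_
  · intro k l hkl
    have hkl' : (k : ℕ) ≤ l := hkl
    dsimp only
    split_ifs with h₁ h₂
    · exact hlam.1 hkl'
    · omega
    · exact hnonneg _
    · exact le_rfl
  · have hφ := mul_left_cancel₀ (pow_ne_zero _ Polynomial.X_ne_zero) (X_pow_mul_charpoly_rhoC φ)
    have hψ := X_pow_mul_charpoly_rhoC ψ
    rw [h, ← hφ, hlam.charpoly_eq] at hψ
    obtain ⟨d, rfl⟩ := Nat.exists_eq_add_of_le hc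
    rw [pow_add, mul_assoc] at hψ
    rw [mul_left_cancel₀ (pow_ne_zero _ Polynomial.X_ne_zero) hψ, Fin.prod_univ_add]
    simp [mul_comm]

end

/-- for `c ≥ ab`, the Kronecker cone `C(a,b,c)` is obtained from
`C(a,b,ab)` by padding the third component with zeros. -/
theorem kronCone_of_large_c (a b c : ℕ) (ha : 1 ≤ a) (hab : a ≤ b)
    (hc : a * b ≤ c) :
    KronCone a b c =
      { lam : (Fin a → ℝ) × (Fin b → ℝ) × (Fin c → ℝ) |
        ∃ lamAB : Fin (a * b) → ℝ,
          (lam.1, lam.2.1, lamAB) ∈ KronCone a b (a * b) ∧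
          lam.2.2 = fun k : Fin c =>
            if h : (k : ℕ) < a * b then lamAB ⟨k, h⟩ else 0 } := by
  ext ⟨lamA, lamB, lamC⟩
  constructor
  · rintro ⟨ψ, hA, hB, hC⟩
    obtain ⟨φ, hφ⟩ := exists_rhoAB_eq ψ
    obtain ⟨lamAB, hlam⟩ := exists_isSpecDown (rhoC_isHermitian φ)
    refine ⟨lamAB, ⟨φ, ?_, ?_, hlam⟩, hC.unique (hlam.rhoC_pad hc hφ.symm)⟩
    · rwa [rhoA_eq_partialTrace, hφ, ← rhoA_eq_partialTrace]
    · rwa [rhoB_eq_partialTrace, hφ, ← rhoB_eq_partialTrace]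
  · rintro ⟨lamAB, ⟨φ, hA, hB, hlam⟩, hC⟩
    obtain ⟨ψ, hψ⟩ := exists_rhoAB_eq_of_le hc φ
    refine ⟨ψ, ?_, ?_, ?_⟩
    · rwa [rhoA_eq_partialTrace, hψ, ← rhoA_eq_partialTrace]
    · rwa [rhoB_eq_partialTrace, hψ, ← rhoB_eq_partialTrace]
    · dsimp only at hC ⊢
      rw [hC]
      exact hlam.rhoC_pad hc hψ

end
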